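/- Let 𝓜 = {M^{(p)} : p > 0} be a weight matrix and 0 < α ≤ 1 be such that lim_{j→∞} (j^{(1-α)j}·M^{(p)}_j)^{1/j} = ∞ for every p > 0, and let 𝓜^α = {M^{(p,α)} : p > 0} be the associated matrix obtained by log-convex regularization. Then A_{{𝓜}}(S_α) = A_{{𝓜^α}}(S_α). -/

import Mathlib

open Filter Complex Asymptotics
open scoped Topology BigOperators

noncomputable section

/-- The open sector in ℂ of opening `α·π` bisected by the positive real axis. -/
def Sector (α : ℝ) : Set ℂ := {z : ℂ | z ≠ 0 ∧ |Complex.arg z| < α * Real.pi / 2}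

/-- The Roumieu ultraholomorphic class `A_{{M}}(S_α)`. -/
def ASet (M : ℕ → ℝ) (α : ℝ) : Set (ℂ → ℂ) :=
  {f | DifferentiableOn ℂ f (Sector α) ∧
    ∃ h > (0:ℝ), ∃ C : ℝ, ∀ j : ℕ, ∀ z ∈ Sector α,
      ‖iteratedDerivWithin j f (Sector α) z‖ ≤ C * h ^ j * M j}

/-- Equivalence of sequences: `a_j ≤ A·B^j·b_j` and `b_j ≤ A·B^j·a_j`. -/
def SeqEquiv (a b : ℕ → ℝ) : Prop :=
  ∃ A > (0:ℝ), ∃ B > (0:ℝ), ∀ j : ℕ, a j ≤ A * B ^ j * b j ∧ b j ≤ A * B ^ j * a j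

/-- Log-convexity: `L_j² ≤ L_{j-1}·L_{j+1}` for `j ≥ 1`. -/
def IsLogConvexSeq (L : ℕ → ℝ) : Prop := ∀ j : ℕ, L (j+1) ^ 2 ≤ L j * L (j+2)

/-- `Gbar s j = j^{s·j}` (with the convention `0⁰ = 1`, automatic for `rpow`). -/
def Gbar (s : ℝ) (j : ℕ) : ℝ := (j : ℝ) ^ (s * (j : ℝ))

/-- Weight matrix: positive sequences, first term 1, nondecreasing in the parameter. -/
def IsWeightMatrix (M : ℝ → ℕ → ℝ) : Prop :=
  (∀ p > (0:ℝ), ∀ j : ℕ, 0 < M p j) ∧ (∀ p > (0:ℝ), M p 0 = 1) ∧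
    (∀ p q : ℝ, 0 < p → p ≤ q → ∀ j : ℕ, M p j ≤ M q j)

/-- The class `A_{{𝓜}}(S_α)` associated with a weight matrix. -/
def AMatSet (M : ℝ → ℕ → ℝ) (α : ℝ) : Set (ℂ → ℂ) := {f | ∃ p > (0:ℝ), f ∈ ASet (M p) α}

/-- `M̌_j = M_j/j!`. -/
def checkSeq (N : ℕ → ℝ) (j : ℕ) : ℝ := N j / (Nat.factorial j : ℝ)

/-- Condition `(𝓜_{rai})`. -/
def Mrai (M : ℝ → ℕ → ℝ) : Prop :=
  ∀ p > (0:ℝ), ∃ C > (0:ℝ), ∃ p' > (0:ℝ), ∀ j k : ℕ, 1 ≤ j → j ≤ k →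
    (checkSeq (M p) j) ^ ((j:ℝ)⁻¹) ≤ C * (checkSeq (M p') k) ^ ((k:ℝ)⁻¹)

/-- Condition `(𝓜_{C^ω})`. -/
def MComega (M : ℝ → ℕ → ℝ) : Prop :=
  ∃ p > (0:ℝ),
    0 < Filter.liminf (fun j : ℕ => (checkSeq (M p) j) ^ ((j:ℝ)⁻¹)) Filter.atTop

/-- Condition `(𝓜_{dc})`. -/
def Mdc (M : ℝ → ℕ → ℝ) : Prop :=
  ∀ p > (0:ℝ), ∃ C > (0:ℝ), ∃ p' > (0:ℝ), ∀ j : ℕ, M p (j+1) ≤ C ^ (j+1) * M p' j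

/-- `N°_k`: maximum of `N_ℓ·N_{j₁}⋯N_{j_ℓ}` over `j_i ∈ ℕ, j₁+⋯+j_ℓ = k`; `N°₀ = 1`. -/
def circSeq (N : ℕ → ℝ) (k : ℕ) : ℝ :=
  if k = 0 then 1 else
    sSup {x : ℝ | ∃ (l : ℕ) (js : Fin l → ℕ), (∀ i, 1 ≤ js i) ∧ (∑ i, js i) = k ∧
      x = N l * ∏ i, N (js i)}

/-- `(rai)` for a single sequence. -/
def SeqRai (N : ℕ → ℝ) : Prop :=
  ∃ C > (0:ℝ), ∀ j k : ℕ, 1 ≤ j → j ≤ k →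
    (checkSeq N j) ^ ((j:ℝ)⁻¹) ≤ C * (checkSeq N k) ^ ((k:ℝ)⁻¹)

/-- `(dc)` for a single sequence. -/
def SeqDc (N : ℕ → ℝ) : Prop := ∃ D ≥ (1:ℝ), ∀ j : ℕ, N (j+1) ≤ D ^ (j+1) * N j

/-- `(FdB)` for a single sequence. -/
def SeqFdB (N : ℕ → ℝ) : Prop :=
  ∃ C ≥ (1:ℝ), ∃ h ≥ (1:ℝ), ∀ j : ℕ, circSeq (checkSeq N) j ≤ C * h ^ j * checkSeq N j

/-- Condition `(𝓜_{FdB})`. -/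
def MFdB (M : ℝ → ℕ → ℝ) : Prop :=
  ∀ p > (0:ℝ), ∃ p' > (0:ℝ), ∃ C : ℝ, ∀ k : ℕ, 1 ≤ k →
    (circSeq (checkSeq (M p)) k / checkSeq (M p') k) ^ ((k:ℝ)⁻¹) ≤ C

/-- `L` is the log-convex minorant of `a` (within positive log-convex sequences). -/
def IsLcMinorant (a L : ℕ → ℝ) : Prop :=
  (∀ j, 0 < L j) ∧ IsLogConvexSeq L ∧ (∀ j, L j ≤ a j) ∧
    ∀ L' : ℕ → ℝ, (∀ j, 0 < L' j) → IsLogConvexSeq L' → (∀ j, L' j ≤ a j) → ∀ j, L' j ≤ L j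

/-- Holomorphic closedness of a class of functions on `S_α`. -/
def HolClosed (S : Set (ℂ → ℂ)) (α : ℝ) : Prop :=
  ∀ f ∈ S, ∀ U : Set ℂ, IsOpen U → closure (f '' Sector α) ⊆ U →
    ∀ g : ℂ → ℂ, DifferentiableOn ℂ g U → g ∘ f ∈ S

/-- Inverse closedness of a class of functions on `S_α`. -/
def InvClosed (S : Set (ℂ → ℂ)) (α : ℝ) : Prop :=
  ∀ f ∈ S, (∃ c > (0:ℝ), ∀ z ∈ Sector α, c ≤ ‖f z‖) → (fun z => (f z)⁻¹) ∈ S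

/-- The class `H_{{𝓜}}(U)` for a weight matrix. -/
def HMatClass (M : ℝ → ℕ → ℝ) (U : Set ℂ) : Set (ℂ → ℂ) :=
  {g | DifferentiableOn ℂ g U ∧ ∀ K : Set ℂ, K ⊆ U → IsCompact K →
    ∃ p > (0:ℝ), ∃ h > (0:ℝ), ∃ C : ℝ, ∀ j : ℕ, ∀ z ∈ K,
      ‖iteratedDerivWithin j g U z‖ ≤ C * h ^ j * M p j}

/-- The class `H_{{M}}(U)` for a single sequence. -/
def HSeqClass (N : ℕ → ℝ) (U : Set ℂ) : Set (ℂ → ℂ) :=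
  {g | DifferentiableOn ℂ g U ∧ ∀ K : Set ℂ, K ⊆ U → IsCompact K →
    ∃ h > (0:ℝ), ∃ C : ℝ, ∀ j : ℕ, ∀ z ∈ K,
      ‖iteratedDerivWithin j g U z‖ ≤ C * h ^ j * N j}

/-- Closedness under composition for the matrix class. -/
def CompClosedMat (M : ℝ → ℕ → ℝ) (α : ℝ) : Prop :=
  ∀ f ∈ AMatSet M α, ∀ U : Set ℂ, IsOpen U → closure (f '' Sector α) ⊆ U →
    ∀ g ∈ HMatClass M U, g ∘ f ∈ AMatSet M α

/-- Closedness under composition for a single-sequence class. -/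
def CompClosedSeq (N : ℕ → ℝ) (α : ℝ) : Prop :=
  ∀ f ∈ ASet N α, ∀ U : Set ℂ, IsOpen U → closure (f '' Sector α) ⊆ U →
    ∀ g ∈ HSeqClass N U, g ∘ f ∈ ASet N α

/-- `f` is characteristic in `A_{{L}}(S_α)`. -/
def Characteristic (L : ℕ → ℝ) (α : ℝ) (f : ℂ → ℂ) : Prop :=
  f ∈ ASet L α ∧ ∀ N : ℕ → ℝ, (∀ j, 0 < N j) → N 0 = 1 →
    f ∈ ASet N α → ASet N α ⊆ ASet L α → ASet N α = ASet L α

/-- Coefficient `2^{-n} M_n/m_n^n` of the `T_M`-transform. -/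
def coefT (M : ℕ → ℝ) (n : ℕ) : ℝ := (1/2:ℝ)^n * (M n / (M (n+1) / M n) ^ n)

/-- The sequence of quotients `m_n = M_{n+1}/M_n`. -/
def quotSeq (M : ℕ → ℝ) (n : ℕ) : ℝ := M (n+1) / M n

/-- `R_j = ∑ 2^{-n}(M_n/m_n^n) m_n^j` (as a real tsum). -/
def Rseq (M : ℕ → ℝ) (j : ℕ) : ℝ := ∑' n : ℕ, coefT M n * (quotSeq M n) ^ j

/-- The `T_M`-transform. -/
def Ttrans (M : ℕ → ℝ) (f : ℂ → ℂ) (z : ℂ) : ℂ :=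
  ∑' n : ℕ, (coefT M n : ℂ) * f ((quotSeq M n : ℂ) * z)

/-- Weight function: continuous, nondecreasing, `ω(0)=0`, nonnegative, `ω(t)→∞`. -/
def IsWeightFunction (ω : ℝ → ℝ) : Prop :=
  ContinuousOn ω (Set.Ici 0) ∧ MonotoneOn ω (Set.Ici 0) ∧ ω 0 = 0 ∧
    (∀ t ≥ (0:ℝ), 0 ≤ ω t) ∧ Filter.Tendsto ω Filter.atTop Filter.atTop

def Om0 (ω : ℝ → ℝ) : Prop := ∀ t ∈ Set.Icc (0:ℝ) 1, ω t = 0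
def Om1 (ω : ℝ → ℝ) : Prop := ∃ L ≥ (1:ℝ), ∀ t ≥ (0:ℝ), ω (2*t) ≤ L * (ω t + 1)
def Om2 (ω : ℝ → ℝ) : Prop := ∃ C > (0:ℝ), ∃ t₀ : ℝ, ∀ t ≥ t₀, ω t ≤ C * t
def Om3 (ω : ℝ → ℝ) : Prop := Real.log =o[Filter.atTop] ω
def Om4 (ω : ℝ → ℝ) : Prop := ConvexOn ℝ Set.univ (fun t => ω (Real.exp t))
def Om5 (ω : ℝ → ℝ) : Prop := ω =o[Filter.atTop] (fun t => t)
def Om6 (ω : ℝ → ℝ) : Prop := ∃ H ≥ (1:ℝ), ∀ t ≥ (0:ℝ), 2 * ω t ≤ ω (H * t) + H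

/-- Condition `(α₀)` for a weight function. -/
def Alpha0 (ω : ℝ → ℝ) : Prop :=
  ∃ C ≥ (1:ℝ), ∃ t₀ ≥ (0:ℝ), ∀ lam ≥ (1:ℝ), ∀ t ≥ t₀, ω (lam * t) ≤ C * lam * ω t

/-- The set `W₀`. -/
def InW0 (ω : ℝ → ℝ) : Prop := IsWeightFunction ω ∧ Om0 ω ∧ Om3 ω ∧ Om4 ω

/-- The set `W`. -/
def InW (ω : ℝ → ℝ) : Prop := InW0 ω ∧ Om1 ω

/-- The Legendre–Fenchel–Young conjugate `φ*_ω`. -/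
def phiStar (ω : ℝ → ℝ) (x : ℝ) : ℝ :=
  sSup {r : ℝ | ∃ y : ℝ, 0 ≤ y ∧ r = x * y - ω (Real.exp y)}

/-- The weight matrix associated with `ω`: `W^{(ℓ)}_j = exp((1/ℓ)·φ*_ω(ℓj))`. -/
def Wmat (ω : ℝ → ℝ) (ℓ : ℝ) (j : ℕ) : ℝ := Real.exp ((1/ℓ) * phiStar ω (ℓ * (j:ℝ)))

/-- The class `A_{{ω}}(S_α)`. -/
def AOmegaSet (ω : ℝ → ℝ) (α : ℝ) : Set (ℂ → ℂ) :=
  {f | DifferentiableOn ℂ f (Sector α) ∧ ∃ ℓ > (0:ℝ), ∃ C : ℝ,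
    ∀ j : ℕ, ∀ z ∈ Sector α, ‖iteratedDerivWithin j f (Sector α) z‖ ≤ C * Wmat ω ℓ j}

/-- Closedness under composition for the `ω`-class. -/
def CompClosedOmega (ω : ℝ → ℝ) (α : ℝ) : Prop :=
  ∀ f ∈ AOmegaSet ω α, ∀ U : Set ℂ, IsOpen U → closure (f '' Sector α) ⊆ U →
    ∀ g ∈ HMatClass (Wmat ω) U, g ∘ f ∈ AOmegaSet ω α

/-- One-sided matrix comparison `𝓜 {⪯} 𝓛`: `sup_{j≥1}(M^{(p)}_j/L^{(q)}_j)^{1/j} < ∞`. -/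
def MatPreceq (M L : ℝ → ℕ → ℝ) : Prop :=
  ∀ p > (0:ℝ), ∃ q > (0:ℝ), ∃ C : ℝ, ∀ j : ℕ, 1 ≤ j → (M p j / L q j) ^ ((j:ℝ)⁻¹) ≤ C

/-- `R`-equivalence of weight matrices. -/
def REquivMat (M L : ℝ → ℕ → ℝ) : Prop := MatPreceq M L ∧ MatPreceq L M

/-- Membership in the sector expressed through two half-plane conditions. -/
theorem sector_iff {α : ℝ} (hα : 0 < α) (hα1 : α ≤ 1) (z : ℂ) :
    z ∈ Sector α ↔ 0 < (z * Complex.exp ((α * Real.pi / 2 : ℝ) * I)).im ∧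
      (z * Complex.exp ((-(α * Real.pi / 2) : ℝ) * I)).im < 0 := by
  set β : ℝ := α * Real.pi / 2 with hβ
  have hpi := Real.pi_pos
  have hβ0 : 0 < β := by positivity
  have hβ1 : β ≤ Real.pi / 2 := by rw [hβ]; nlinarith
  have key : ∀ t : ℝ, (z * Complex.exp ((t : ℝ) * I)).im = ‖z‖ * Real.sin (arg z + t) := by
    intro t
    conv_lhs => rw [← Complex.norm_mul_exp_arg_mul_I z]
    rw [mul_assoc, ← Complex.exp_add, ← add_mul, ← Complex.ofReal_add, Complex.im_ofReal_mul,
      Complex.exp_ofReal_mul_I_im]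
  rw [key, key]
  have h1 := Complex.neg_pi_lt_arg z
  have h2 := Complex.arg_le_pi z
  constructor
  · rintro ⟨hz, h⟩
    rw [← hβ, abs_lt] at h
    have hn : 0 < ‖z‖ := norm_pos_iff.2 hz
    refine ⟨mul_pos hn (Real.sin_pos_of_pos_of_lt_pi (by linarith) (by linarith)), ?_⟩
    exact mul_neg_of_pos_of_neg hn
      (Real.sin_neg_of_neg_of_neg_pi_lt (by linarith) (by linarith))
  · rintro ⟨ha, hb⟩
    have hz : z ≠ 0 := by
      rintro rfl
      simp at ha
    have hn : 0 < ‖z‖ := norm_pos_iff.2 hz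
    refine ⟨hz, ?_⟩
    rw [← hβ, abs_lt]
    have ha' : 0 < Real.sin (arg z + β) := by
      by_contra hc
      exact absurd ha (not_lt.2 (mul_nonpos_of_nonneg_of_nonpos hn.le (not_lt.1 hc)))
    have hb' : Real.sin (arg z + -β) < 0 := by
      by_contra hc
      exact absurd hb (not_lt.2 (mul_nonneg hn.le (not_lt.1 hc)))
    constructor
    · by_contra hc
      have := Real.sin_nonpos_of_nonpos_of_neg_pi_le (x := arg z + β) (by linarith) (by linarith)
      linarith
    · by_contra hc
      have := Real.sin_nonneg_of_nonneg_of_le_pi (x := arg z + -β) (by linarith) (by linarith)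
      linarith

/-- The closed sector (as an intersection of two half-planes). -/
def ClSector (α : ℝ) : Set ℂ :=
  {u : ℂ | 0 ≤ (u * Complex.exp ((α * Real.pi / 2 : ℝ) * I)).im ∧
      (u * Complex.exp ((-(α * Real.pi / 2) : ℝ) * I)).im ≤ 0}

theorem sector_add {α : ℝ} (hα : 0 < α) (hα1 : α ≤ 1) {z u : ℂ} (hz : z ∈ Sector α)
    (hu : u ∈ ClSector α) : z + u ∈ Sector α := by
  rw [sector_iff hα hα1] at hz ⊢
  obtain ⟨h1, h2⟩ := hz
  obtain ⟨h3, h4⟩ := hu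
  rw [add_mul, add_mul, Complex.add_im, Complex.add_im]
  constructor <;> linarith

theorem clSector_smul {α : ℝ} {u : ℂ} (hu : u ∈ ClSector α) {t : ℝ} (ht : 0 ≤ t) :
    (t : ℂ) * u ∈ ClSector α := by
  obtain ⟨h3, h4⟩ := hu
  refine ⟨?_, ?_⟩
  · rw [mul_assoc, Complex.im_ofReal_mul]; exact mul_nonneg ht h3
  · rw [mul_assoc, Complex.im_ofReal_mul]; exact mul_nonpos_of_nonneg_of_nonpos ht h4

theorem sector_isOpen {α : ℝ} (hα : 0 < α) (hα1 : α ≤ 1) : IsOpen (Sector α) := by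
  have : Sector α = {z : ℂ | 0 < (z * Complex.exp ((α * Real.pi / 2 : ℝ) * I)).im} ∩
      {z : ℂ | (z * Complex.exp ((-(α * Real.pi / 2) : ℝ) * I)).im < 0} := by
    ext z; exact sector_iff hα hα1 z
  rw [this]
  exact (isOpen_lt (by fun_prop) (by fun_prop)).inter (isOpen_lt (by fun_prop) (by fun_prop))

/-- Taylor's formula with remainder bound along segments in the sector. -/
theorem taylor_sector {α : ℝ} (hα : 0 < α) (hα1 : α ≤ 1) (n : ℕ) :
    ∀ (F : ℕ → ℂ → ℂ) (_ : ∀ j, ∀ z ∈ Sector α, HasDerivAt (F j) (F (j+1) z) z)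
      (D : ℝ) (_ : ∀ z ∈ Sector α, ‖F n z‖ ≤ D) (z u : ℂ) (_ : z ∈ Sector α)
      (_ : u ∈ ClSector α),
      ‖F 0 (z + u) - ∑ j ∈ Finset.range n, F j z / (Nat.factorial j : ℂ) * u ^ j‖
        ≤ D * ‖u‖ ^ n / (Nat.factorial n : ℝ) := by
  induction n with
  | zero =>
    intro F hF D hD z u hz hu
    simpa using hD _ (sector_add hα hα1 hz hu)
  | succ n ih =>
    intro F hF D hD z u hz hu
    have ih' := ih (fun j => F (j+1)) (fun j => hF (j+1)) D hD z
    have hmem : ∀ t : ℝ, 0 ≤ t → z + (t:ℂ) * u ∈ Sector α := fun t ht =>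
      sector_add hα hα1 hz (clSector_smul hu ht)
    let g : ℝ → ℂ := fun t => F 0 (z + (t:ℂ) * u) -
      ∑ j ∈ Finset.range (n+1), F j z / (Nat.factorial j : ℂ) * ((t:ℂ) * u) ^ j
    let g' : ℝ → ℂ := fun t => u * (F 1 (z + (t:ℂ) * u) -
      ∑ j ∈ Finset.range n, F (j+1) z / (Nat.factorial j : ℂ) * ((t:ℂ) * u) ^ j)
    have hlin : ∀ t : ℝ, HasDerivAt (fun s : ℝ => (s:ℂ) * u) u t := fun t => by
      simpa using (Complex.ofRealCLM.hasDerivAt (x := t)).mul_const u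
    have hg : ∀ t : ℝ, 0 ≤ t → HasDerivAt g (g' t) t := by
      intro t ht
      have h1 : HasDerivAt (fun s : ℝ => F 0 (z + (s:ℂ) * u)) (F 1 (z + (t:ℂ)*u) * u) t :=
        (hF 0 _ (hmem t ht)).comp t ((hlin t).const_add z)
      have h2 : HasDerivAt (fun s : ℝ => ∑ j ∈ Finset.range (n+1),
          F j z / (Nat.factorial j : ℂ) * ((s:ℂ) * u) ^ j)
          (∑ j ∈ Finset.range (n+1), F j z / (Nat.factorial j : ℂ) *
            ((j:ℂ) * ((t:ℂ) * u) ^ (j-1) * u)) t := by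
        refine HasDerivAt.fun_sum fun j _ => ?_
        exact ((hlin t).pow j).const_mul _
      have h3 := h1.sub h2
      refine h3.congr_deriv ?_
      symm
      rw [Finset.sum_range_succ']
      simp only [g', mul_sub, Finset.mul_sum]
      simp only [Nat.cast_zero, zero_mul, mul_zero, add_zero, Nat.add_sub_cancel]
      congr 1
      · ring
      · refine Finset.sum_congr rfl fun j _ => ?_
        have : (Nat.factorial j : ℂ) ≠ 0 := by exact_mod_cast Nat.factorial_ne_zero j
        have h' : ((j:ℂ) + 1) ≠ 0 := by exact_mod_cast Nat.succ_ne_zero j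
        rw [Nat.factorial_succ]
        push_cast
        field_simp
    have hD0 : 0 ≤ D := (norm_nonneg _).trans (hD z hz)
    have hfac : (0:ℝ) < Nat.factorial n := by exact_mod_cast Nat.factorial_pos n
    have := image_norm_le_of_norm_deriv_right_le_deriv_boundary (f := g) (f' := g') (a := 0)
      (b := 1) (fun t ht => (hg t ht.1).continuousAt.continuousWithinAt)
      (fun t ht => (hg t ht.1).hasDerivWithinAt)
      (B := fun t => D * ‖u‖ ^ (n+1) / (Nat.factorial (n+1) : ℝ) * t ^ (n+1))
      (B' := fun t => D * ‖u‖ ^ (n+1) / (Nat.factorial (n+1) : ℝ) * ((n+1 : ℕ) * t ^ n))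
      (by simp [g, Finset.sum_range_succ'])
      (fun t => by
        have h := (hasDerivAt_pow (n+1) t).const_mul
            (D * ‖u‖ ^ (n+1) / (Nat.factorial (n+1) : ℝ))
        rwa [Nat.add_sub_cancel] at h)
      (fun t ht => by
        have h := ih' ((t:ℂ) * u) hz (clSector_smul hu ht.1)
        simp only [g', norm_mul]
        refine (mul_le_mul_of_nonneg_left h (norm_nonneg u)).trans (le_of_eq ?_)
        rw [Nat.factorial_succ, norm_mul, Complex.norm_real, Real.norm_of_nonneg ht.1]
        push_cast
        have : ((n:ℝ) + 1) ≠ 0 := by positivity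
        rw [mul_pow]
        field_simp
        ring)
      (x := 1) (by simp)
    simpa [g] using this

/-- The elementary entropy inequality. -/
theorem entropy_ineq (i k n : ℕ) (hik : i < k) (hkn : k < n) :
    ((k:ℝ) - i) * Real.log (((n:ℝ) - i) / ((k:ℝ) - i)) ≤ k * Real.log 2
      + (1 - ((k:ℝ) - i) / ((n:ℝ) - i)) * (i * Real.log i)
      + ((k:ℝ) - i) / ((n:ℝ) - i) * (n * Real.log n) - k * Real.log k := by
  have h1 : (i:ℝ) < k := by exact_mod_cast hik
  have h2 : (k:ℝ) < n := by exact_mod_cast hkn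
  have hi : (0:ℝ) ≤ i := by positivity
  set a : ℝ := (i:ℝ)
  set b : ℝ := (k:ℝ)
  set c : ℝ := (n:ℝ)
  set θ : ℝ := (b - a) / (c - a) with hθ
  have hca : 0 < c - a := by linarith
  have hba : 0 < b - a := by linarith
  have hθ0 : 0 < θ := div_pos hba hca
  have hθ1 : θ < 1 := by rw [hθ, div_lt_one hca]; linarith
  have hinv : (c - a) / (b - a) = θ⁻¹ := by rw [hθ, inv_div]
  have hθc : θ * (c - a) = b - a := by rw [hθ]; field_simp
  rw [hinv, Real.log_inv]
  have hlogθ : Real.log θ ≤ 0 := Real.log_nonpos hθ0.le hθ1.le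
  have hb : 0 < b := by linarith
  have hc : 0 < c := by linarith
  have ent : ∀ w : ℝ, 0 ≤ w → w * Real.log b - w * Real.log 2 - w * Real.log w ≤ b / 2 - w := by
    intro w hw
    rcases hw.eq_or_lt with h | h
    · rw [← h]; simp; linarith
    · have := Real.log_le_sub_one_of_pos (x := b / (2 * w)) (by positivity)
      rw [Real.log_div hb.ne' (by positivity), Real.log_mul (by norm_num) h.ne'] at this
      have h' := mul_le_mul_of_nonneg_left this hw
      have e : w * (b / (2 * w) - 1) = b / 2 - w := by field_simp
      linarith
  have e1 := ent ((1 - θ) * a) (mul_nonneg (by linarith) hi)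
  have e2 := ent (θ * c) (by positivity)
  have hw2 : Real.log (θ * c) = Real.log θ + Real.log c := Real.log_mul hθ0.ne' hc.ne'
  have hw1 : (1 - θ) * a * Real.log ((1 - θ) * a) ≤ (1 - θ) * a * Real.log a := by
    rcases hi.eq_or_lt with h | h
    · rw [← h]; simp
    · apply mul_le_mul_of_nonneg_left _ (mul_nonneg (by linarith) hi)
      apply Real.log_le_log (mul_pos (by linarith) h)
      nlinarith
  have hsum : (1 - θ) * a + θ * c = b := by linarith
  have h5 : (θ * c - (b - a)) * Real.log θ ≤ 0 :=
    mul_nonpos_of_nonneg_of_nonpos (by nlinarith) hlogθ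
  rw [hw2] at e2
  have h6 : b * Real.log b = (1 - θ) * a * Real.log b + θ * c * Real.log b := by
    rw [← add_mul, hsum]
  have h7 : b * Real.log 2 = (1 - θ) * a * Real.log 2 + θ * c * Real.log 2 := by
    rw [← add_mul, hsum]
  rw [h6, h7]
  nlinarith

/-- An affine minorant: if `c` lies below all chords then it lies below the minorant. -/
theorem le_minorant {a L : ℕ → ℝ} (ha : ∀ j, 0 < a j) (hL : IsLcMinorant a L) (k : ℕ)
    (hk : 1 ≤ k) (c : ℝ) (hck : c ≤ Real.log (a k))
    (hc : ∀ i n : ℕ, i < k → k < n → c * ((n:ℝ) - i) ≤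
      ((n:ℝ) - k) * Real.log (a i) + ((k:ℝ) - i) * Real.log (a n)) :
    Real.exp c ≤ L k := by
  have hne : (Finset.range k).Nonempty := ⟨0, Finset.mem_range.2 hk⟩
  obtain ⟨i₀, hi₀, hmax⟩ := Finset.exists_max_image (Finset.range k)
    (fun i : ℕ => (c - Real.log (a i)) / ((k:ℝ) - i)) hne
  rw [Finset.mem_range] at hi₀
  set s : ℝ := (c - Real.log (a i₀)) / ((k:ℝ) - i₀) with hs
  have hlow : ∀ j : ℕ, c + s * ((j:ℝ) - k) ≤ Real.log (a j) := by
    intro j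
    rcases lt_trichotomy j k with h | h | h
    · have h' := hmax j (Finset.mem_range.2 h)
      have hj : (0:ℝ) < (k:ℝ) - j := by
        have : (j:ℝ) < k := by exact_mod_cast h
        linarith
      rw [div_le_iff₀ hj] at h'
      linarith
    · subst h; simpa using hck
    · have h' := hc i₀ j hi₀ h
      have h1 : (0:ℝ) < (k:ℝ) - i₀ := by
        have : (i₀:ℝ) < k := by exact_mod_cast hi₀
        linarith
      have hsk : s * ((k:ℝ) - i₀) = c - Real.log (a i₀) := by rw [hs]; field_simp
      have : (c + s * ((j:ℝ) - k)) * ((k:ℝ) - i₀) ≤ Real.log (a j) * ((k:ℝ) - i₀) := by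
        have e : s * ((j:ℝ) - k) * ((k:ℝ) - i₀) = ((j:ℝ) - k) * (c - Real.log (a i₀)) := by
          rw [← hsk]; ring
        rw [add_mul, e]
        nlinarith
      exact le_of_mul_le_mul_right this h1
  have := hL.2.2.2 (fun j => Real.exp (c + s * ((j:ℝ) - k))) (fun j => Real.exp_pos _)
    (fun j => by
      rw [← Real.exp_add, sq, ← Real.exp_add]
      apply le_of_eq
      congr 1
      push_cast
      ring)
    (fun j => by
      rw [← Real.le_log_iff_exp_le (ha j)]
      exact hlow j) k
  simpa using this

/-- The exterior-type map whose boundary values lie in the closed sector. -/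
def psiMap (γ : ℝ) (v : ℂ) : ℂ := -((1 - v) ^ (γ : ℂ)) / v

theorem psiMap_mem {α : ℝ} (hα : 0 < α) (hα1 : α ≤ 1) {v : ℂ} (hv : ‖v‖ = 1) :
    psiMap (2 - α) v ∈ ClSector α := by
  by_cases h1 : v = 1
  · subst h1
    have : psiMap (2 - α) 1 = 0 := by
      have h2 : ((2 - α : ℝ) : ℂ) ≠ 0 := by
        rw [Ne, Complex.ofReal_eq_zero]; linarith
      simp only [psiMap, sub_self]
      rw [Complex.zero_cpow h2]; simp
    rw [this]
    simp [ClSector]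
  have hw : 1 - v ≠ 0 := fun h => h1 (by linear_combination -h)
  set ψ := arg (1 - v) with hψ
  set s := ‖1 - v‖ with hs
  have hs0 : 0 < s := norm_pos_iff.2 hw
  have hre : s * Real.cos ψ = (1 - v).re := Complex.norm_mul_cos_arg _
  have hs2 : s ^ 2 = 2 * (1 - v).re := by
    rw [hs, Complex.sq_norm, Complex.normSq_apply]
    have : v.re * v.re + v.im * v.im = 1 := by
      rw [← Complex.normSq_apply, ← Complex.sq_norm, hv]; norm_num
    simp only [Complex.sub_re, Complex.sub_im, Complex.one_re, Complex.one_im]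
    nlinarith
  have hsc : s = 2 * Real.cos ψ := by
    have : s * (s - 2 * Real.cos ψ) = 0 := by nlinarith
    rcases mul_eq_zero.1 this with h | h
    · exact absurd h hs0.ne'
    · linarith
  have hcos : 0 < Real.cos ψ := by linarith
  have hpi := Real.pi_pos
  have hψ1 : |ψ| < Real.pi / 2 := by
    by_contra hc
    have hc' := not_lt.1 hc
    have := Real.cos_nonpos_of_pi_div_two_le_of_le hc'
      ((Complex.abs_arg_le_pi _).trans (by linarith))
    rw [Real.cos_abs] at this
    linarith
  have hexp : 1 - v = (s : ℂ) * Complex.exp (ψ * I) := (Complex.norm_mul_exp_arg_mul_I _).symm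
  have hvv : v = -Complex.exp ((2 * ψ : ℝ) * I) := by
    have h3 : (s : ℂ) = Complex.exp (ψ * I) + Complex.exp (-ψ * I) := by
      rw [hsc]; push_cast; rw [Complex.two_cos]
    have h4 : Complex.exp ((2 * ψ : ℝ) * I) = Complex.exp (ψ * I) * Complex.exp (ψ * I) := by
      rw [← Complex.exp_add]; congr 1; push_cast; ring
    have h5 : Complex.exp (-ψ * I) * Complex.exp (ψ * I) = 1 := by
      rw [← Complex.exp_add]; simp
    rw [h3] at hexp
    rw [h4]
    linear_combination -hexp - h5
  have hval : psiMap (2 - α) v =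
      (Real.exp (Real.log s * (2 - α)) : ℝ) * Complex.exp ((-(α * ψ) : ℝ) * I) := by
    have : ∀ a b : ℂ, -a / -b = a / b := fun a b => neg_div_neg_eq a b
    rw [psiMap, Complex.cpow_def_of_ne_zero hw, Complex.log]
    conv_lhs => rw [hvv]
    rw [this, ← Complex.exp_sub, ← hvv, ← hs, ← hψ, Complex.ofReal_exp, ← Complex.exp_add]
    congr 1
    push_cast
    ring
  set E := Real.exp (Real.log s * (2 - α))
  have hE : 0 < E := Real.exp_pos _
  have him : ∀ t : ℝ, (psiMap (2 - α) v * Complex.exp ((t : ℝ) * I)).im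
      = E * Real.sin (-(α * ψ) + t) := by
    intro t
    rw [hval, mul_assoc, ← Complex.exp_add, ← add_mul, ← Complex.ofReal_add,
      Complex.im_ofReal_mul, Complex.exp_ofReal_mul_I_im]
  rw [abs_lt] at hψ1
  have b1 : α * ψ ≤ α * (Real.pi / 2) := mul_le_mul_of_nonneg_left hψ1.2.le hα.le
  have b2 : α * (-(Real.pi / 2)) ≤ α * ψ := mul_le_mul_of_nonneg_left hψ1.1.le hα.le
  have b3 : α * Real.pi ≤ Real.pi := by nlinarith
  refine ⟨?_, ?_⟩
  · rw [him]
    exact mul_nonneg hE.le (Real.sin_nonneg_of_nonneg_of_le_pi (by linarith) (by linarith))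
  · rw [him]
    exact mul_nonpos_of_nonneg_of_nonpos hE.le
      (Real.sin_nonpos_of_nonpos_of_neg_pi_le (by linarith) (by linarith))

theorem psiMap_norm_le {α : ℝ} (hα : 0 < α) (hα1 : α ≤ 1) {v : ℂ} (hv : ‖v‖ = 1) :
    ‖psiMap (2 - α) v‖ ≤ 4 := by
  rw [psiMap, norm_div, norm_neg, hv, div_one, Complex.norm_cpow_real]
  have h2 : ‖1 - v‖ ≤ 2 := (norm_sub_le _ _).trans (by rw [hv]; norm_num)
  calc ‖1 - v‖ ^ (2 - α) ≤ 2 ^ (2 - α) :=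
        Real.rpow_le_rpow (norm_nonneg _) h2 (by linarith)
    _ ≤ 2 ^ (2:ℝ) := Real.rpow_le_rpow_of_exponent_le (by norm_num) (by linarith)
    _ = 4 := by norm_num

/-- Bernstein-Walsh type inequality obtained from the maximum principle. -/
theorem poly_bound {α : ℝ} (hα : 0 < α) (hα1 : α ≤ 1) (c : ℕ → ℂ) (n : ℕ) (B : ℝ)
    (hB : ∀ u ∈ ClSector α, ‖u‖ ≤ 4 → ‖∑ j ∈ Finset.range n, c j * u ^ j‖ ≤ B)
    {v : ℂ} (hv : ‖v‖ ≤ 1) (hv0 : v ≠ 0) :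
    ‖v‖ ^ n * ‖∑ j ∈ Finset.range n, c j * (psiMap (2 - α) v) ^ j‖ ≤ B := by
  let H : ℂ → ℂ := fun v => ∑ j ∈ Finset.range n,
    c j * (v ^ (n - j) * (-((1 - v) ^ ((2 - α : ℝ) : ℂ))) ^ j)
  have hH : ∀ v : ℂ, v ≠ 0 →
      H v = v ^ n * ∑ j ∈ Finset.range n, c j * (psiMap (2 - α) v) ^ j := by
    intro v hv
    simp only [H, Finset.mul_sum]
    refine Finset.sum_congr rfl fun j hj => ?_
    have hj' : j ≤ n := (Finset.mem_range.1 hj).le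
    rw [psiMap, div_pow]
    have : v ^ n = v ^ (n - j) * v ^ j := by rw [← pow_add, Nat.sub_add_cancel hj']
    rw [this]
    field_simp
  have hdiff : DiffContOnCl ℂ H (Metric.ball 0 1) := by
    constructor
    · intro v hv
      have hv' : ‖v‖ < 1 := by simpa using hv
      have hsl : 1 - v ∈ Complex.slitPlane := by
        left
        have := Complex.re_le_norm v
        simp; linarith
      have hq : DifferentiableAt ℂ (fun v : ℂ => (1 - v) ^ ((2 - α : ℝ) : ℂ)) v := by
        have h : DifferentiableAt ℂ (fun v : ℂ => 1 - v) v := by fun_prop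
        exact h.cpow_const hsl
      apply DifferentiableAt.differentiableWithinAt
      apply DifferentiableAt.fun_sum
      intro j _
      exact (((differentiableAt_id.pow (n-j)).mul (hq.neg.pow j))).const_mul (c j)
    · rw [closure_ball _ one_ne_zero]
      intro v hv
      have hv' : ‖v‖ ≤ 1 := by simpa using hv
      have hq : ContinuousAt (fun v : ℂ => (1 - v) ^ ((2 - α : ℝ) : ℂ)) v := by
        have h : ContinuousAt (fun v : ℂ => 1 - v) v := by fun_prop
        have h2 : ContinuousAt (fun x : ℂ => x ^ ((2 - α : ℝ) : ℂ)) (1 - v) := by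
          apply Complex.continuousAt_cpow_const_of_re_pos
          · left
            have := Complex.re_le_norm v
            simp; linarith
          · rw [Complex.ofReal_re]; linarith
        exact ContinuousAt.comp (f := fun v : ℂ => 1 - v) h2 h
      apply ContinuousAt.continuousWithinAt
      apply tendsto_finsetSum
      intro j _
      exact ((continuousAt_id.pow (n-j)).mul (hq.neg.pow j)).const_mul (c j)
  have := Complex.norm_le_of_forall_mem_frontier_norm_le Metric.isBounded_ball hdiff (C := B)
    (fun w hw => by
      rw [frontier_ball _ one_ne_zero] at hw
      have hw' : ‖w‖ = 1 := by simpa using hw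
      have hw0 : w ≠ 0 := by rintro rfl; simp at hw'
      rw [hH w hw0, norm_mul, norm_pow, hw', one_pow, one_mul]
      exact hB _ (psiMap_mem hα hα1 hw') (psiMap_norm_le hα hα1 hw'))
    (z := v) (by rw [closure_ball _ one_ne_zero]; simpa using hv)
  rwa [hH v hv0, norm_mul, norm_pow] at this

/-- Logarithmic derivative of `psiMap`. -/
def psiLog (γ : ℝ) (v : ℂ) : ℂ := -(v⁻¹ + γ * (1 - v)⁻¹)

theorem one_sub_slit {v : ℂ} (hv : ‖v‖ < 1) : 1 - v ∈ Complex.slitPlane := by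
  left
  have := Complex.re_le_norm v
  simp; linarith

theorem psiMap_ne_zero (γ : ℝ) {v : ℂ} (hv : ‖v‖ < 1) (hv0 : v ≠ 0) : psiMap γ v ≠ 0 := by
  have h := Complex.slitPlane_ne_zero (one_sub_slit hv)
  rw [psiMap]
  refine div_ne_zero (neg_ne_zero.2 ?_) hv0
  rw [Complex.cpow_def_of_ne_zero h]
  exact Complex.exp_ne_zero _

theorem psiMap_hasDerivAt (γ : ℝ) {v : ℂ} (hv : ‖v‖ < 1) (hv0 : v ≠ 0) :
    HasDerivAt (psiMap γ) (psiMap γ v * psiLog γ v) v := by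
  have hsl := one_sub_slit hv
  have hne := Complex.slitPlane_ne_zero hsl
  have h1 : HasDerivAt (fun w : ℂ => 1 - w) (-1) v := by
    simpa using (hasDerivAt_id v).const_sub 1
  have h2 := ((h1.cpow_const (c := (γ:ℂ)) hsl).neg).div (hasDerivAt_id v) hv0
  refine h2.congr_deriv ?_
  rw [psiMap, psiLog, Complex.cpow_sub _ _ hne, Complex.cpow_one]
  simp only [id, Pi.neg_apply]
  field_simp
  ring

theorem psi_integral (γ : ℝ) {r : ℝ} (hr : 0 < r) (hr1 : r < 1) (m : ℤ) :
    (∮ v in C(0, r), psiMap γ v ^ m * psiLog γ v) =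
      if m = 0 then -(2 * Real.pi * I) else 0 := by
  have hsph : ∀ v ∈ Metric.sphere (0:ℂ) r, ‖v‖ < 1 ∧ v ≠ 0 := by
    intro v hv
    have : ‖v‖ = r := by simpa using hv
    refine ⟨by linarith, ?_⟩
    rintro rfl
    simp at this; linarith
  split_ifs with hm
  · subst hm
    have hA : (∮ v in C(0, r), (v - 0)⁻¹) = 2 * Real.pi * I :=
      circleIntegral.integral_sub_inv_of_mem_ball (by simpa using hr)
    have hB : (∮ v in C(0, r), (1 - v)⁻¹) = 0 := by
      apply circleIntegral.integral_eq_zero_of_hasDerivWithinAt hr.le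
        (f := fun v => -Complex.log (1 - v))
      intro v hv
      have h1 : HasDerivAt (fun w : ℂ => 1 - w) (-1) v := by
        simpa using (hasDerivAt_id v).const_sub 1
      have := (h1.clog (one_sub_slit (hsph v hv).1)).neg
      refine (this.congr_deriv ?_).hasDerivWithinAt
      simp [neg_div]
    have iA : CircleIntegrable (fun v : ℂ => (v - 0)⁻¹) 0 r := by
      apply ContinuousOn.circleIntegrable hr.le
      intro v hv
      have := (hsph v hv).2
      apply ContinuousAt.continuousWithinAt
      exact ContinuousAt.inv₀ (by fun_prop) (by simpa using this)
    have iB : CircleIntegrable (fun v : ℂ => (γ:ℂ) * (1 - v)⁻¹) 0 r := by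
      apply ContinuousOn.circleIntegrable hr.le
      intro v hv
      have := Complex.slitPlane_ne_zero (one_sub_slit (hsph v hv).1)
      apply ContinuousAt.continuousWithinAt
      exact (ContinuousAt.inv₀ (by fun_prop) this).const_mul _
    have e : (fun v : ℂ => psiMap γ v ^ (0:ℤ) * psiLog γ v) =
        fun v => (-1 : ℂ) * ((v - 0)⁻¹ + (γ:ℂ) * (1 - v)⁻¹) := by
      funext v; simp [psiLog]
    rw [e, circleIntegral.integral_const_mul, circleIntegral.integral_add iA iB,
      circleIntegral.integral_const_mul, hA, hB]
    ring
  · apply circleIntegral.integral_eq_zero_of_hasDerivWithinAt hr.le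
      (f := fun v => (m:ℂ)⁻¹ * psiMap γ v ^ m)
    intro v hv
    obtain ⟨h1, h2⟩ := hsph v hv
    have hne := psiMap_ne_zero γ h1 h2
    have := ((hasDerivAt_zpow m (psiMap γ v) (Or.inl hne)).comp v
      (psiMap_hasDerivAt γ h1 h2)).const_mul (m:ℂ)⁻¹
    refine (this.congr_deriv ?_).hasDerivWithinAt
    have hm' : (m:ℂ) ≠ 0 := by exact_mod_cast hm
    rw [zpow_sub_one₀ hne]
    field_simp

theorem poisson_integral {r : ℝ} (hr : 0 < r) (hr1 : r < 1) :
    ∫ t in (0:ℝ)..(2 * Real.pi), (‖1 - circleMap 0 r t‖ ^ 2)⁻¹ = 2 * Real.pi / (1 - r ^ 2) := by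
  have hd : DiffContOnCl ℂ (fun z : ℂ => (1 - z)⁻¹) (Metric.ball 0 r) := by
    apply DifferentiableOn.diffContOnCl
    rw [closure_ball _ hr.ne']
    intro v hv
    have hv' : ‖v‖ ≤ r := by simpa using hv
    have := Complex.slitPlane_ne_zero (one_sub_slit (lt_of_le_of_lt hv' hr1))
    apply DifferentiableAt.differentiableWithinAt
    exact DifferentiableAt.inv (by fun_prop) this
  have hmem : ((r ^ 2 : ℝ) : ℂ) ∈ Metric.ball (0:ℂ) r := by
    rw [mem_ball_zero_iff, Complex.norm_real, Real.norm_of_nonneg (by positivity)]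
    nlinarith
  have h := hd.circleIntegral_sub_inv_smul hmem
  rw [circleIntegral] at h
  have hpt : ∀ t : ℝ, deriv (circleMap 0 r) t •
      ((circleMap 0 r t - ((r ^ 2 : ℝ) : ℂ))⁻¹ • (1 - circleMap 0 r t)⁻¹) =
      I * (((‖1 - circleMap 0 r t‖ ^ 2)⁻¹ : ℝ) : ℂ) := by
    intro t
    rw [deriv_circleMap]
    set v := circleMap 0 r t with hv
    have hn : ‖v‖ = r := by rw [hv]; simp [abs_of_pos hr]
    have hv0 : v ≠ 0 := by
      intro h0; rw [h0] at hn; simp at hn; linarith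
    have h1 : 1 - v ≠ 0 := Complex.slitPlane_ne_zero (one_sub_slit (by linarith))
    have hc : v * (starRingEnd ℂ) v = ((r ^ 2 : ℝ) : ℂ) := by
      rw [Complex.mul_conj, ← Complex.sq_norm, hn]
    have hc1 : ((‖1 - v‖ ^ 2 : ℝ) : ℂ) = (1 - v) * (1 - (starRingEnd ℂ) v) := by
      rw [Complex.sq_norm, ← Complex.mul_conj]; simp
    have h2 : 1 - (starRingEnd ℂ) v ≠ 0 := by
      intro h0
      apply h1
      have := congrArg (starRingEnd ℂ) h0
      simpa using this
    rw [Complex.ofReal_inv, hc1, ← hc]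
    have h3 : v - v * (starRingEnd ℂ) v = v * (1 - (starRingEnd ℂ) v) := by ring
    rw [h3]
    simp only [smul_eq_mul]
    field_simp
  simp only [hpt] at h
  rw [intervalIntegral.integral_const_mul, intervalIntegral.integral_ofReal, smul_eq_mul] at h
  have h' : ((∫ t in (0:ℝ)..(2 * Real.pi), (‖1 - circleMap 0 r t‖ ^ 2)⁻¹ : ℝ) : ℂ) =
      ((2 * Real.pi / (1 - r ^ 2) : ℝ) : ℂ) := by
    have hI := Complex.I_ne_zero
    apply mul_left_cancel₀ hI
    rw [h]
    push_cast
    ring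
  exact_mod_cast h'

/-- Coefficient bound, in terms of a free radius. -/
theorem coeff_bound_r {α : ℝ} (hα : 0 < α) (hα1 : α ≤ 1) (c : ℕ → ℂ) (n k : ℕ) (hk : 1 ≤ k)
    (hkn : k < n) (B : ℝ) (hB0 : 0 ≤ B)
    (hB : ∀ u ∈ ClSector α, ‖u‖ ≤ 4 → ‖∑ j ∈ Finset.range n, c j * u ^ j‖ ≤ B)
    {r : ℝ} (hr : 0 < r) (hr1 : r < 1) :
    ‖c k‖ ≤ 2 * B * (r ^ n)⁻¹ * ((1 - r) ^ ((2 - α) * k))⁻¹ := by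
  set γ : ℝ := 2 - α with hγ
  have hk' : (1:ℝ) ≤ k := by exact_mod_cast hk
  have hγk : 1 ≤ γ * k := by nlinarith
  have hsph : ∀ v ∈ Metric.sphere (0:ℂ) r, ‖v‖ < 1 ∧ v ≠ 0 := by
    intro v hv
    have : ‖v‖ = r := by simpa using hv
    refine ⟨by linarith, ?_⟩
    rintro rfl
    simp at this; linarith
  let G : ℂ → ℂ := fun v => (∑ j ∈ Finset.range n, c j * psiMap γ v ^ j) *
    (psiMap γ v ^ (-(k:ℤ)) * psiLog γ v)
  have hG : (∮ v in C(0, r), G v) = -(2 * Real.pi * I) * c k := by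
    have e : ∀ v ∈ Metric.sphere (0:ℂ) r, G v = ∑ j ∈ Finset.range n,
        c j * (psiMap γ v ^ ((j:ℤ) - k) * psiLog γ v) := by
      intro v hv
      obtain ⟨h1, h2⟩ := hsph v hv
      have hne := psiMap_ne_zero γ h1 h2
      simp only [G, Finset.sum_mul]
      refine Finset.sum_congr rfl fun j _ => ?_
      rw [zpow_sub₀ hne, zpow_neg, zpow_natCast, zpow_natCast, div_eq_mul_inv]
      ring
    rw [circleIntegral.integral_congr hr.le e, circleIntegral.integral_fun_sum]
    · simp only [circleIntegral.integral_const_mul, psi_integral γ hr hr1]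
      rw [Finset.sum_eq_single k]
      · simp; ring
      · intro j _ hj
        rw [if_neg (by omega), mul_zero]
      · intro h; exact absurd (Finset.mem_range.2 hkn) h
    · intro j _
      apply ContinuousOn.circleIntegrable hr.le
      intro v hv
      obtain ⟨h1, h2⟩ := hsph v hv
      have hne := psiMap_ne_zero γ h1 h2
      have hs := Complex.slitPlane_ne_zero (one_sub_slit h1)
      apply ContinuousAt.continuousWithinAt
      refine ContinuousAt.const_mul ?_ _
      refine ((psiMap_hasDerivAt γ h1 h2).continuousAt.zpow₀ _ (Or.inl hne)).mul ?_
      unfold psiLog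
      exact ((continuousAt_id.inv₀ h2).add
        ((ContinuousAt.inv₀ (by fun_prop) hs).const_mul _)).neg
  set K : ℝ := B * (r ^ n)⁻¹ * ((1 - r) ^ (γ * k - 1))⁻¹ * (2 / r) with hK
  have h1r : 0 < 1 - r := by linarith
  have hGb : ∀ v ∈ Metric.sphere (0:ℂ) r, ‖G v‖ ≤ K * (‖1 - v‖ ^ 2)⁻¹ := by
    intro v hv
    obtain ⟨h1, h2⟩ := hsph v hv
    have hvr : ‖v‖ = r := by simpa using hv
    have hs := Complex.slitPlane_ne_zero (one_sub_slit h1)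
    have hd : 0 < ‖1 - v‖ := norm_pos_iff.2 hs
    have hdr : 1 - r ≤ ‖1 - v‖ := by
      have := norm_sub_norm_le (1:ℂ) v
      rw [hvr, norm_one] at this; exact this
    have hP := poly_bound hα hα1 c n B hB h1.le h2
    rw [hvr, ← hγ] at hP
    have hP' : ‖∑ j ∈ Finset.range n, c j * psiMap γ v ^ j‖ ≤ B * (r ^ n)⁻¹ := by
      rw [← div_eq_mul_inv, le_div_iff₀ (by positivity), mul_comm]; exact hP
    have hz : ‖psiMap γ v ^ (-(k:ℤ))‖ ≤ (‖1 - v‖ ^ (γ * k))⁻¹ := by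
      rw [norm_zpow, zpow_neg, zpow_natCast]
      apply inv_anti₀ (by positivity)
      rw [psiMap, norm_div, norm_neg, hvr, Complex.norm_cpow_real, Real.rpow_mul hd.le,
        Real.rpow_natCast]
      apply pow_le_pow_left₀ (by positivity)
      rw [le_div_iff₀ hr]
      exact mul_le_of_le_one_right (by positivity) hr1.le
    have hl : ‖psiLog γ v‖ ≤ (2 / r) * ‖1 - v‖⁻¹ := by
      have e : psiLog γ v = -((1 + ((γ - 1 : ℝ) : ℂ) * v) / (v * (1 - v))) := by
        rw [psiLog]; push_cast; field_simp; ring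
      rw [e, norm_neg, norm_div, norm_mul, hvr, ← div_eq_mul_inv, div_div]
      apply div_le_div_of_nonneg_right _ (by positivity)
      refine (norm_add_le _ _).trans ?_
      rw [norm_one, norm_mul, Complex.norm_real, Real.norm_of_nonneg (by linarith), hvr]
      nlinarith
    have hsplit : (‖1 - v‖ ^ (γ * k))⁻¹ * ‖1 - v‖⁻¹ ≤
        ((1 - r) ^ (γ * k - 1))⁻¹ * (‖1 - v‖ ^ 2)⁻¹ := by
      have e : ‖1 - v‖ ^ (γ * k) = ‖1 - v‖ ^ (γ * k - 1) * ‖1 - v‖ := by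
        rw [← Real.rpow_add_one hd.ne']; congr 1; ring
      rw [e, mul_inv, mul_assoc, ← mul_inv, ← sq]
      apply mul_le_mul_of_nonneg_right _ (by positivity)
      apply inv_anti₀ (by positivity)
      exact Real.rpow_le_rpow h1r.le hdr (by linarith)
    calc ‖G v‖ = ‖∑ j ∈ Finset.range n, c j * psiMap γ v ^ j‖ *
          (‖psiMap γ v ^ (-(k:ℤ))‖ * ‖psiLog γ v‖) := by simp only [G, norm_mul]
      _ ≤ (B * (r ^ n)⁻¹) * ((‖1 - v‖ ^ (γ * k))⁻¹ * ((2 / r) * ‖1 - v‖⁻¹)) := by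
          gcongr
      _ = (B * (r ^ n)⁻¹ * (2 / r)) * ((‖1 - v‖ ^ (γ * k))⁻¹ * ‖1 - v‖⁻¹) := by ring
      _ ≤ (B * (r ^ n)⁻¹ * (2 / r)) * (((1 - r) ^ (γ * k - 1))⁻¹ * (‖1 - v‖ ^ 2)⁻¹) := by
          gcongr
      _ = K * (‖1 - v‖ ^ 2)⁻¹ := by rw [hK]; ring
  have hcirc : ∀ t : ℝ, circleMap 0 r t ∈ Metric.sphere (0:ℂ) r := fun t =>
    circleMap_mem_sphere _ hr.le t
  have hpi := Real.pi_pos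
  have hint : ‖∮ v in C(0, r), G v‖ ≤ r * K * (2 * Real.pi / (1 - r ^ 2)) := by
    rw [← poisson_integral hr hr1, ← intervalIntegral.integral_const_mul, circleIntegral]
    apply intervalIntegral.norm_integral_le_of_norm_le (by positivity)
    · refine Filter.Eventually.of_forall fun t _ => ?_
      rw [norm_smul, deriv_circleMap, norm_mul, Complex.norm_I, mul_one, norm_circleMap_zero,
        abs_of_pos hr, mul_assoc]
      exact mul_le_mul_of_nonneg_left (hGb _ (hcirc t)) hr.le
    · apply Continuous.intervalIntegrable
      apply Continuous.mul continuous_const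
      apply Continuous.inv₀
      · exact ((continuous_const.sub (continuous_circleMap 0 r)).norm).pow 2
      · intro t
        have := Complex.slitPlane_ne_zero (one_sub_slit (hsph _ (hcirc t)).1)
        exact pow_ne_zero _ (norm_ne_zero_iff.2 this)
  rw [hG, norm_mul, norm_neg] at hint
  have hn2 : ‖(2 * Real.pi * I : ℂ)‖ = 2 * Real.pi := by
    simp [abs_of_pos hpi]
  rw [hn2] at hint
  have h1r2 : 0 < 1 - r ^ 2 := by nlinarith
  have hc1 : ‖c k‖ ≤ r * K / (1 - r ^ 2) := by
    have : 2 * Real.pi * ‖c k‖ ≤ 2 * Real.pi * (r * K / (1 - r ^ 2)) := by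
      refine hint.trans (le_of_eq ?_); ring
    exact le_of_mul_le_mul_left this (by positivity)
  refine hc1.trans ?_
  have e1 : r * K / (1 - r ^ 2) = 2 * B * (r ^ n)⁻¹ * (((1 - r) ^ (γ * k - 1))⁻¹ *
      (1 - r ^ 2)⁻¹) := by
    rw [hK]; field_simp
  rw [e1]
  apply mul_le_mul_of_nonneg_left _ (by positivity)
  have e2 : (1 - r) ^ (γ * k) = (1 - r) ^ (γ * k - 1) * (1 - r) := by
    rw [← Real.rpow_add_one h1r.ne']; congr 1; ring
  rw [e2, mul_inv]
  apply mul_le_mul_of_nonneg_left _ (by positivity)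
  apply inv_anti₀ h1r
  nlinarith

/-- Coefficient bound in logarithmic form, for a general radius. -/
theorem coeff_bound_log {α : ℝ} (hα : 0 < α) (hα1 : α ≤ 1) (c : ℕ → ℂ) (n k : ℕ) (hk : 1 ≤ k)
    (hkn : k < n) (B : ℝ) (hB0 : 0 < B) (R : ℝ) (hR : 0 < R)
    (hB : ∀ u ∈ ClSector α, ‖u‖ ≤ R → ‖∑ j ∈ Finset.range n, c j * u ^ j‖ ≤ B)
    (hc : c k ≠ 0) :
    Real.log ‖c k‖ ≤ Real.log (2 * B) + k + (2 - α) * k * Real.log (2 * n / k)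
      + k * Real.log 4 - k * Real.log R := by
  have hk' : (0:ℝ) < k := by exact_mod_cast hk
  have hkn' : (k:ℝ) < n := by exact_mod_cast hkn
  have hn' : (0:ℝ) < n := hk'.trans hkn'
  have hr : (0:ℝ) < n / (n + k) := by positivity
  have hr1 : (n:ℝ) / (n + k) < 1 := by rw [div_lt_one (by positivity)]; linarith
  have h := coeff_bound_r hα hα1 (fun j => c j * (((R / 4) ^ j : ℝ) : ℂ)) n k hk hkn B hB0.le
    (fun u hu hu4 => by
      have h1 := hB (((R / 4 : ℝ) : ℂ) * u) (clSector_smul hu (by positivity)) (by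
        rw [norm_mul, Complex.norm_real, Real.norm_of_nonneg (by positivity)]
        nlinarith)
      refine le_trans (le_of_eq ?_) h1
      congr 1
      refine Finset.sum_congr rfl fun j _ => ?_
      rw [mul_pow]; push_cast; ring) hr hr1
  have h1r : 1 - (n:ℝ) / (n + k) = k / (n + k) := by field_simp; ring
  rw [h1r, norm_mul, Complex.norm_real, Real.norm_of_nonneg (by positivity)] at h
  have hcn : 0 < ‖c k‖ := norm_pos_iff.2 hc
  have hq : (0:ℝ) < k / (n + k) := by positivity
  have hl := Real.log_le_log (by positivity) h
  rw [Real.log_mul (by positivity) (by positivity), Real.log_mul (by positivity) (by positivity),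
    Real.log_mul (by positivity) (by positivity), Real.log_inv, Real.log_inv, Real.log_pow,
    Real.log_pow, Real.log_rpow hq, Real.log_div hR.ne' (by norm_num)] at hl
  have e1 : -((n:ℝ) * Real.log (n / (n + k))) ≤ k := by
    have : Real.log (((n:ℝ) + k) / n) ≤ k / n := by
      refine (Real.log_le_sub_one_of_pos (by positivity)).trans (le_of_eq ?_)
      field_simp; ring
    have e : Real.log ((n:ℝ) / (n + k)) = - Real.log (((n:ℝ) + k) / n) := by
      rw [← Real.log_inv, inv_div]
    rw [e]
    have h2 := mul_le_mul_of_nonneg_left this hn'.le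
    have h3 : (n:ℝ) * (k / n) = k := by field_simp
    linarith
  have e2 : -((2 - α) * k * Real.log ((k:ℝ) / (n + k))) ≤
      (2 - α) * k * Real.log (2 * n / k) := by
    have e : Real.log ((k:ℝ) / (n + k)) = - Real.log (((n:ℝ) + k) / k) := by
      rw [← Real.log_inv, inv_div]
    rw [e]
    have : Real.log (((n:ℝ) + k) / k) ≤ Real.log (2 * n / k) := by
      apply Real.log_le_log (by positivity)
      apply div_le_div_of_nonneg_right _ hk'.le
      linarith
    have h0 : 0 ≤ (2 - α) * k := mul_nonneg (by linarith) hk'.le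
    nlinarith
  linarith

/-- Landau-Kolmogorov inequality in a sector, starting from order zero. -/
theorem landau_zero {α : ℝ} (hα : 0 < α) (hα1 : α ≤ 1) (F : ℕ → ℂ → ℂ)
    (hF : ∀ j, ∀ z ∈ Sector α, HasDerivAt (F j) (F (j+1) z) z) (n k : ℕ) (hk : 1 ≤ k)
    (hkn : k < n) (D₀ D₁ : ℝ) (h0 : 0 < D₀) (h1 : 0 < D₁) (hD₀ : ∀ z ∈ Sector α, ‖F 0 z‖ ≤ D₀)
    (hD₁ : ∀ z ∈ Sector α, ‖F n z‖ ≤ D₁) (z : ℂ) (hz : z ∈ Sector α) (hne : F k z ≠ 0) :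
    Real.log ‖F k z‖ ≤ Real.log 4 + 6 * k + (1 - (k:ℝ) / n) * Real.log D₀
      + (k:ℝ) / n * Real.log D₁ + (1 - α) * (k * Real.log ((n:ℝ) / k)) := by
  have hk' : (0:ℝ) < k := by exact_mod_cast hk
  have hkn' : (k:ℝ) < n := by exact_mod_cast hkn
  have hn' : (0:ℝ) < n := hk'.trans hkn'
  have hnf : (0:ℝ) < Nat.factorial n := by exact_mod_cast Nat.factorial_pos n
  have hkf : (0:ℝ) < Nat.factorial k := by exact_mod_cast Nat.factorial_pos k
  set x : ℝ := (Real.log (Nat.factorial n) + Real.log D₀ - Real.log D₁) / n with hx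
  have hxn : (n:ℝ) * x = Real.log (Nat.factorial n) + Real.log D₀ - Real.log D₁ := by
    rw [hx]; field_simp
  have hRn : D₁ * Real.exp x ^ n / (Nat.factorial n : ℝ) = D₀ := by
    rw [← Real.exp_nat_mul, hxn, Real.exp_sub, Real.exp_add, Real.exp_log hnf, Real.exp_log h0,
      Real.exp_log h1]
    field_simp
  have hb := coeff_bound_log hα hα1 (fun j => F j z / (Nat.factorial j : ℂ)) n k hk hkn
    (2 * D₀) (by positivity) (Real.exp x) (Real.exp_pos x)
    (fun u hu hur => by
      have ht := taylor_sector hα hα1 n F hF D₁ hD₁ z u hz hu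
      have h2 : D₁ * ‖u‖ ^ n / (Nat.factorial n : ℝ) ≤ D₀ := by
        rw [← hRn]; gcongr
      have h3 := hD₀ _ (sector_add hα hα1 hz hu)
      rw [norm_sub_rev] at ht
      have h4 := norm_le_norm_add_norm_sub' (∑ j ∈ Finset.range n,
        F j z / (Nat.factorial j : ℂ) * u ^ j) (F 0 (z + u))
      linarith)
    (div_ne_zero hne (by exact_mod_cast Nat.factorial_ne_zero k))
  have hFn : 0 < ‖F k z‖ := norm_pos_iff.2 hne
  rw [norm_div, Complex.norm_natCast, Real.log_div hFn.ne' hkf.ne', Real.log_exp,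
    ← mul_assoc, Real.log_mul (by norm_num) h0.ne', mul_div_assoc,
    Real.log_mul (x := 2) (y := (n:ℝ) / k) (by norm_num) (by positivity)] at hb
  have f1 : Real.log (Nat.factorial k) ≤ k * Real.log k := by
    rw [← Real.log_pow]
    apply Real.log_le_log hkf
    exact_mod_cast Nat.factorial_le_pow k
  have f2 : (n:ℝ) * Real.log n - n ≤ Real.log (Nat.factorial n) := by
    have h5 := Real.pow_div_factorial_le_exp (x := (n:ℝ)) hn'.le n
    have h6 := Real.log_le_log (by positivity) h5
    rw [Real.log_div (by positivity) hnf.ne', Real.log_pow, Real.log_exp] at h6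
    linarith
  have l2 : Real.log 2 ≤ 1 := by
    have := Real.log_le_sub_one_of_pos (x := 2) (by norm_num); linarith
  have l4 : Real.log 4 ≤ 2 := by
    have : (4:ℝ) = 2 ^ 2 := by norm_num
    rw [this, Real.log_pow]; push_cast; linarith
  have l22 : Real.log (2 * 2) = Real.log 4 := by norm_num
  have hkx : (k:ℝ) * x = (k:ℝ) / n * Real.log (Nat.factorial n) + (k:ℝ) / n * Real.log D₀
      - (k:ℝ) / n * Real.log D₁ := by
    rw [hx]; field_simp
  have f3 : (k:ℝ) * Real.log n - k ≤ (k:ℝ) / n * Real.log (Nat.factorial n) := by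
    have := mul_le_mul_of_nonneg_left f2 (a := (k:ℝ) / n) (by positivity)
    refine le_trans (le_of_eq ?_) this
    field_simp
  have lnk : Real.log ((n:ℝ) / k) = Real.log n - Real.log k := Real.log_div hn'.ne' hk'.ne'
  have g1 : (k:ℝ) * Real.log 4 ≤ k * 2 := mul_le_mul_of_nonneg_left l4 hk'.le
  have g2 : (2 - α) * k * Real.log 2 ≤ 2 * k := by
    have a1 : (k:ℝ) * Real.log 2 ≤ k * 1 := mul_le_mul_of_nonneg_left l2 hk'.le
    have a2 : 0 ≤ (k:ℝ) * Real.log 2 := mul_nonneg hk'.le (Real.log_nonneg (by norm_num))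
    nlinarith
  rw [l22, hkx, lnk] at hb
  rw [lnk]
  have e : (2 - α) * k * (Real.log 2 + (Real.log n - Real.log k)) =
    (2 - α) * k * Real.log 2 + (1 - α) * (k * (Real.log n - Real.log k)) + k * Real.log n
      - k * Real.log k := by ring
  rw [e] at hb
  linarith

/-- Landau-Kolmogorov inequality in a sector. -/
theorem landau {α : ℝ} (hα : 0 < α) (hα1 : α ≤ 1) (F : ℕ → ℂ → ℂ)
    (hF : ∀ j, ∀ z ∈ Sector α, HasDerivAt (F j) (F (j+1) z) z) (i k n : ℕ) (hik : i < k)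
    (hkn : k < n) (D : ℕ → ℝ) (hD0 : ∀ j, 0 < D j) (hD : ∀ j, ∀ z ∈ Sector α, ‖F j z‖ ≤ D j)
    (z : ℂ) (hz : z ∈ Sector α) (hne : F k z ≠ 0) :
    Real.log ‖F k z‖ ≤ Real.log 4 + 6 * ((k:ℝ) - i)
      + (1 - ((k:ℝ) - i) / ((n:ℝ) - i)) * Real.log (D i)
      + ((k:ℝ) - i) / ((n:ℝ) - i) * Real.log (D n)
      + (1 - α) * (((k:ℝ) - i) * Real.log (((n:ℝ) - i) / ((k:ℝ) - i))) := by
  obtain ⟨a, rfl⟩ := Nat.exists_eq_add_of_lt hik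
  obtain ⟨b, rfl⟩ := Nat.exists_eq_add_of_lt hkn
  have h := landau_zero hα hα1 (fun j => F (i + j)) (fun j => hF (i + j)) (a + 1 + b + 1) (a + 1)
    (by omega) (by omega) (D i) (D (i + a + 1 + b + 1)) (hD0 _) (hD0 _) (hD i)
    (by
      have e : i + (a + 1 + b + 1) = i + a + 1 + b + 1 := by omega
      rw [e]
      exact hD (i + a + 1 + b + 1)) z hz hne
  have e1 : ((i + a + 1 : ℕ) : ℝ) - i = ((a + 1 : ℕ) : ℝ) := by push_cast; ring
  have e2 : ((i + a + 1 + b + 1 : ℕ) : ℝ) - i = ((a + 1 + b + 1 : ℕ) : ℝ) := by push_cast; ring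
  rw [e1, e2]
  exact h

theorem log_Gbar (s : ℝ) (j : ℕ) : Real.log (Gbar s j) = s * (j * Real.log j) := by
  rcases Nat.eq_zero_or_pos j with h | h
  · subst h; simp [Gbar]
  · rw [Gbar, Real.log_rpow (by exact_mod_cast h)]; ring

theorem Gbar_pos (s : ℝ) (j : ℕ) : 0 < Gbar s j := by
  rcases Nat.eq_zero_or_pos j with h | h
  · subst h; simp [Gbar]
  · exact Real.rpow_pos_of_pos (by exact_mod_cast h) _

/-- The key inclusion for a single sequence. -/
theorem aset_subset {α : ℝ} (hα : 0 < α) (hα1 : α ≤ 1) (M L : ℕ → ℝ) (hM : ∀ j, 0 < M j)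
    (hL : IsLcMinorant (fun j => Gbar (1 - α) j * M j) L) :
    ASet M α ⊆ ASet (fun j => Gbar (α - 1) j * L j) α := by
  rintro f ⟨hf, h, hh, C, hC⟩
  have hopen := sector_isOpen hα hα1
  let F : ℕ → ℂ → ℂ := fun j => iteratedDerivWithin j f (Sector α)
  have hF : ∀ j, ∀ z ∈ Sector α, HasDerivAt (F j) (F (j+1) z) z := by
    intro j z hz
    have hcd : ContDiffOn ℂ ((j + 1 : ℕ) : WithTop ℕ∞) f (Sector α) := hf.contDiffOn hopen
    have hd := hcd.differentiableOn_iteratedDerivWithin (m := j)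
      (by exact_mod_cast Nat.lt_succ_self j) hopen.uniqueDiffOn
    have h1 := (hd z hz).hasDerivWithinAt
    rw [← iteratedDerivWithin_succ] at h1
    exact h1.hasDerivAt (hopen.mem_nhds hz)
  set C1 : ℝ := |C| + 1 with hC1
  have hC1p : 0 < C1 := by positivity
  let D : ℕ → ℝ := fun j => C1 * h ^ j * M j
  have hDp : ∀ j, 0 < D j := fun j => mul_pos (by positivity) (hM j)
  have hD : ∀ j, ∀ z ∈ Sector α, ‖F j z‖ ≤ D j := by
    intro j z hz
    refine (hC j z hz).trans ?_
    have : C ≤ C1 := (le_abs_self C).trans (by linarith)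
    exact mul_le_mul_of_nonneg_right (mul_le_mul_of_nonneg_right this (by positivity)) (hM j).le
  have hlogD : ∀ j, Real.log (D j) = Real.log C1 + j * Real.log h + Real.log (M j) := by
    intro j
    rw [Real.log_mul (by positivity) (hM j).ne', Real.log_mul hC1p.ne' (by positivity),
      Real.log_pow]
  let a : ℕ → ℝ := fun j => Gbar (1 - α) j * M j
  have hap : ∀ j, 0 < a j := fun j => mul_pos (Gbar_pos _ _) (hM j)
  have hloga : ∀ j, Real.log (a j) = (1 - α) * (j * Real.log j) + Real.log (M j) := by
    intro j
    rw [Real.log_mul (Gbar_pos _ _).ne' (hM j).ne', log_Gbar]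
  set A₀ : ℝ := Real.log 4 + Real.log C1 with hA₀
  set B₀ : ℝ := 6 + Real.log 2 + Real.log h with hB₀
  have hl2 : 0 < Real.log 2 := Real.log_pos (by norm_num)
  have hl4 : 0 < Real.log 4 := Real.log_pos (by norm_num)
  have hLp := hL.1
  have key : ∀ k : ℕ, 1 ≤ k → ∀ z ∈ Sector α,
      ‖F k z‖ ≤ Real.exp A₀ * Real.exp B₀ ^ k * (Gbar (α - 1) k * L k) := by
    intro k hk z hz
    have hGL : 0 < Gbar (α - 1) k * L k := mul_pos (Gbar_pos _ _) (hLp k)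
    by_cases hne : F k z = 0
    · rw [hne, norm_zero]; positivity
    have hx : 0 < ‖F k z‖ := norm_pos_iff.2 hne
    have hk' : (0:ℝ) < k := by exact_mod_cast hk
    set c : ℝ := Real.log ‖F k z‖ + (1 - α) * (k * Real.log k) - A₀ - k * B₀ with hc
    have hexp := le_minorant hap hL k hk c
      (by
        have h1 := Real.log_le_log hx (hD k z hz)
        rw [hlogD] at h1
        rw [hloga, hc, hA₀, hB₀]
        nlinarith)
      (fun i n hik hkn => by
        have h1 := landau hα hα1 F hF i k n hik hkn D hDp hD z hz hne
        have h2 := entropy_ineq i k n hik hkn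
        have hik' : (i:ℝ) < k := by exact_mod_cast hik
        have hkn' : (k:ℝ) < n := by exact_mod_cast hkn
        have hni : (0:ℝ) < (n:ℝ) - i := by linarith
        set θ : ℝ := ((k:ℝ) - i) / ((n:ℝ) - i) with hθ
        have hθn : θ * ((n:ℝ) - i) = (k:ℝ) - i := by rw [hθ]; field_simp
        have hi0 : (0:ℝ) ≤ i := by positivity
        have h3 := mul_le_mul_of_nonneg_left h2 (a := 1 - α) (by linarith)
        rw [hlogD, hlogD] at h1
        have h4 : (1 - α) * (k * Real.log 2) ≤ k * Real.log 2 :=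
          mul_le_of_le_one_left (by positivity) (by linarith)
        have h5 : (1 - θ) * (i * Real.log h) + θ * (n * Real.log h) = k * Real.log h := by
          linear_combination Real.log h * hθn
        have h6 : c ≤ (1 - θ) * Real.log (a i) + θ * Real.log (a n) := by
          rw [hloga, hloga, hc, hA₀, hB₀]
          nlinarith
        have h7 := mul_le_mul_of_nonneg_right h6 hni.le
        refine h7.trans (le_of_eq ?_)
        linear_combination (Real.log (a n) - Real.log (a i)) * hθn)
    rw [← Real.le_log_iff_exp_le (hLp k)] at hexp
    rw [← Real.log_le_log_iff hx (by positivity), Real.log_mul (by positivity) hGL.ne',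
      Real.log_mul (by positivity) (by positivity), Real.log_pow, Real.log_exp, Real.log_exp,
      Real.log_mul (Gbar_pos _ _).ne' (hLp k).ne', log_Gbar]
    rw [hc] at hexp
    nlinarith
  refine ⟨hf, Real.exp B₀, Real.exp_pos _, Real.exp A₀ + C1 * M 0 / L 0, ?_⟩
  intro j z hz
  have hq : 0 < C1 * M 0 / L 0 := div_pos (mul_pos hC1p (hM 0)) (hLp 0)
  rcases Nat.eq_zero_or_pos j with hj | hj
  · subst hj
    have h1 := hD 0 z hz
    have h2 : C1 * M 0 / L 0 * L 0 = C1 * M 0 := div_mul_cancel₀ _ (hLp 0).ne'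
    have h3 : Gbar (α - 1) 0 = 1 := by simp [Gbar]
    have h4 : D 0 = C1 * M 0 := by simp [D]
    have h5 : 0 < Real.exp A₀ * L 0 := mul_pos (Real.exp_pos _) (hLp 0)
    simp only [h3, pow_zero, mul_one, one_mul]
    change ‖F 0 z‖ ≤ _
    rw [add_mul, h2]
    linarith
  · refine (key j hj z hz).trans ?_
    have hGL : 0 < Gbar (α - 1) j * L j := mul_pos (Gbar_pos _ _) (hLp j)
    apply mul_le_mul_of_nonneg_right _ hGL.le
    apply mul_le_mul_of_nonneg_right _ (by positivity)
    linarith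

/-- for `0 < α ≤ 1` and a weight matrix with
`lim (j^{(1-α)j}M^{(p)}_j)^{1/j} = ∞`, the classes given by `𝓜` and the regularized matrix
`𝓜^α` (with `M^{(p,α)}_j = j^{(α-1)j}·L^{(p)}_j`, `L^{(p)}` the log-convex minorant of
`(j^{(1-α)j}M^{(p)}_j)_j`) coincide on `S_α`. -/
theorem stmt_7 (M : ℝ → ℕ → ℝ) (hM : IsWeightMatrix M)
    (α : ℝ) (hα : 0 < α) (hα1 : α ≤ 1)
    (hlim : ∀ p > (0:ℝ), Filter.Tendsto
      (fun j : ℕ => (Gbar (1 - α) j * M p j) ^ ((j:ℝ)⁻¹)) Filter.atTop Filter.atTop)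
    (Lmin : ℝ → ℕ → ℝ)
    (hLmin : ∀ p > (0:ℝ), IsLcMinorant (fun j => Gbar (1 - α) j * M p j) (Lmin p)) :
    AMatSet M α = AMatSet (fun p j => Gbar (α - 1) j * Lmin p j) α := by
  ext f
  constructor
  · rintro ⟨p, hp, hf⟩
    exact ⟨p, hp, aset_subset hα hα1 (M p) (Lmin p) (hM.1 p hp) (hLmin p hp) hf⟩
  · rintro ⟨p, hp, hf, h, hh, C, hC⟩
    refine ⟨p, hp, hf, h, hh, |C|, fun j z hz => (hC j z hz).trans ?_⟩
    have hL := hLmin p hp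
    have hg : Gbar (α - 1) j * Gbar (1 - α) j = 1 := by
      apply Real.eq_one_of_pos_of_log_eq_zero (mul_pos (Gbar_pos _ _) (Gbar_pos _ _))
      rw [Real.log_mul (Gbar_pos _ _).ne' (Gbar_pos _ _).ne', log_Gbar, log_Gbar]
      ring
    have h1 : Gbar (α - 1) j * Lmin p j ≤ M p j := by
      have h2 := mul_le_mul_of_nonneg_left (hL.2.2.1 j) (Gbar_pos (α - 1) j).le
      have h3 : Gbar (α - 1) j * (Gbar (1 - α) j * M p j) = M p j := by
        rw [← mul_assoc, hg, one_mul]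
      linarith
    have h0 : 0 ≤ Gbar (α - 1) j * Lmin p j := mul_nonneg (Gbar_pos _ _).le (hL.1 j).le
    exact mul_le_mul (mul_le_mul_of_nonneg_right (le_abs_self C) (by positivity)) h1 h0
      (by positivity)
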